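/- For any c > 0 and c' ∈ ℝ, with a = (1-√c)² and b = (1+√c)², ∫_a^b xⁿ · c'(x + 1 - c)/(2πx√((b-x)(x-a))) dx = ∑_{π ∈ NC(n)} #(π) · c^{#(π)-1} · c' for every n ≥ 1. -/

import Mathlib

/-- `P` is a partition of `Fin n` into nonempty blocks. -/
def IsPartition {n : ℕ} (P : Finset (Finset (Fin n))) : Prop :=
  (∀ B ∈ P, B.Nonempty) ∧ ∀ x : Fin n, ∃! B, B ∈ P ∧ x ∈ B

/-- `P` is non-crossing. -/
def IsNonCrossing {n : ℕ} (P : Finset (Finset (Fin n))) : Prop :=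
  ∀ B₁ ∈ P, ∀ B₂ ∈ P, ∀ a ∈ B₁, ∀ b ∈ B₂, ∀ c ∈ B₁, ∀ d ∈ B₂,
    a < b → b < c → c < d → B₁ = B₂

open Classical in
/-- The set of non-crossing partitions of `[n]`, as a `Finset`. -/
noncomputable def NC (n : ℕ) : Finset (Finset (Finset (Fin n))) :=
  Finset.univ.filter fun P => IsPartition P ∧ IsNonCrossing P

/-- `P` is a non-crossing partition of the finite set `s`. -/
structure IsNonCrossingPartitionOn {α : Type*} [LinearOrder α] (s : Finset α)
    (P : Finset (Finset α)) : Prop where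
  nonempty : ∀ B ∈ P, B.Nonempty
  subset : ∀ B ∈ P, ∀ x ∈ B, x ∈ s
  cover : ∀ x ∈ s, ∃ B ∈ P, x ∈ B
  unique : ∀ B₁ ∈ P, ∀ B₂ ∈ P, ∀ x ∈ B₁, x ∈ B₂ → B₁ = B₂
  nonCrossing : ∀ B₁ ∈ P, ∀ B₂ ∈ P, ∀ a ∈ B₁, ∀ b ∈ B₂, ∀ c ∈ B₁, ∀ d ∈ B₂,
    a < b → b < c → c < d → B₁ = B₂

open Classical in
/-- The non-crossing partitions of a finite subset of a linear order. -/
noncomputable def nonCrossingPartitionsOn {α : Type*} [LinearOrder α] (s : Finset α) :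
    Finset (Finset (Finset α)) :=
  s.powerset.powerset.filter (IsNonCrossingPartitionOn s)

theorem mem_nonCrossingPartitionsOn {α : Type*} [LinearOrder α] {s : Finset α}
    {P : Finset (Finset α)} :
    P ∈ nonCrossingPartitionsOn s ↔ IsNonCrossingPartitionOn s P := by
  simp only [nonCrossingPartitionsOn, Finset.mem_filter, Finset.mem_powerset, and_iff_right_iff_imp]
  intro h B hB
  exact Finset.mem_powerset.2 (h.subset B hB)

theorem NC_eq_nonCrossingPartitionsOn (n : ℕ) :
    NC n = nonCrossingPartitionsOn (Finset.univ : Finset (Fin n)) := by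
  ext P
  simp only [NC, Finset.mem_filter, Finset.mem_univ, true_and, mem_nonCrossingPartitionsOn]
  constructor
  · rintro ⟨⟨h₁, h₂⟩, h₃⟩
    exact ⟨h₁, fun _ _ _ _ => Finset.mem_univ _, fun x _ => (h₂ x).exists,
      fun B₁ hB₁ B₂ hB₂ x hx₁ hx₂ => (h₂ x).unique ⟨hB₁, hx₁⟩ ⟨hB₂, hx₂⟩, h₃⟩
  · intro h
    refine ⟨⟨h.nonempty, fun x => ?_⟩, h.nonCrossing⟩
    obtain ⟨B, hB, hx⟩ := h.cover x (Finset.mem_univ x)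
    exact ⟨B, ⟨hB, hx⟩, fun B' h' => h.unique B' h'.1 B hB x h'.2 hx⟩

theorem isNonCrossingPartitionOn_map {α β : Type*} [LinearOrder α] [LinearOrder β] (f : α ↪o β)
    (s : Finset α) (P : Finset (Finset α)) :
    IsNonCrossingPartitionOn (s.map f.toEmbedding)
        (P.map (Finset.mapEmbedding f.toEmbedding).toEmbedding) ↔
      IsNonCrossingPartitionOn s P := by
  have hmem : ∀ B, B ∈ P.map (Finset.mapEmbedding f.toEmbedding).toEmbedding ↔
      ∃ C ∈ P, C.map f.toEmbedding = B := fun B => Finset.mem_map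
  have hmap : ∀ {x : α} {u : Finset α}, f x ∈ u.map f.toEmbedding ↔ x ∈ u :=
    Finset.mem_map' f.toEmbedding
  constructor
  · intro h
    have hm : ∀ B ∈ P, B.map f.toEmbedding ∈
        P.map (Finset.mapEmbedding f.toEmbedding).toEmbedding :=
      fun B hB => (hmem _).2 ⟨B, hB, rfl⟩
    constructor
    · exact fun B hB => Finset.map_nonempty.1 (h.nonempty _ (hm B hB))
    · exact fun B hB x hx => hmap.1 (h.subset _ (hm B hB) (f x) (hmap.2 hx))
    · intro x hx
      obtain ⟨B, hB, hxB⟩ := h.cover (f x) (hmap.2 hx)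
      obtain ⟨C, hC, rfl⟩ := (hmem B).1 hB
      exact ⟨C, hC, hmap.1 hxB⟩
    · intro B₁ h₁ B₂ h₂ x hx₁ hx₂
      exact Finset.map_injective _ (h.unique _ (hm B₁ h₁) _ (hm B₂ h₂) (f x)
        (hmap.2 hx₁) (hmap.2 hx₂))
    · intro B₁ h₁ B₂ h₂ a ha b hb c hc d hd hab hbc hcd
      exact Finset.map_injective _ (h.nonCrossing _ (hm B₁ h₁) _ (hm B₂ h₂) (f a) (hmap.2 ha)
        (f b) (hmap.2 hb) (f c) (hmap.2 hc) (f d) (hmap.2 hd) (f.lt_iff_lt.2 hab)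
        (f.lt_iff_lt.2 hbc) (f.lt_iff_lt.2 hcd))
  · intro h
    constructor
    · intro B hB
      obtain ⟨C, hC, rfl⟩ := (hmem B).1 hB
      exact Finset.map_nonempty.2 (h.nonempty C hC)
    · intro B hB
      obtain ⟨C, hC, rfl⟩ := (hmem B).1 hB
      exact fun x hx => Finset.map_subset_map.2 (h.subset C hC) hx
    · intro x hx
      obtain ⟨y, hy, rfl⟩ := Finset.mem_map.1 hx
      obtain ⟨B, hB, hyB⟩ := h.cover y hy
      exact ⟨_, (hmem _).2 ⟨B, hB, rfl⟩, hmap.2 hyB⟩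
    · intro B₁ h₁ B₂ h₂ x hx₁ hx₂
      obtain ⟨C₁, hC₁, rfl⟩ := (hmem B₁).1 h₁
      obtain ⟨C₂, hC₂, rfl⟩ := (hmem B₂).1 h₂
      obtain ⟨y, hy, rfl⟩ := Finset.mem_map.1 hx₁
      rw [h.unique C₁ hC₁ C₂ hC₂ y hy (hmap.1 hx₂)]
    · intro B₁ h₁ B₂ h₂ a ha b hb c hc d hd hab hbc hcd
      obtain ⟨C₁, hC₁, rfl⟩ := (hmem B₁).1 h₁
      obtain ⟨C₂, hC₂, rfl⟩ := (hmem B₂).1 h₂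
      obtain ⟨a, ha', rfl⟩ := Finset.mem_map.1 ha
      obtain ⟨b, hb', rfl⟩ := Finset.mem_map.1 hb
      obtain ⟨c, hc', rfl⟩ := Finset.mem_map.1 hc
      obtain ⟨d, hd', rfl⟩ := Finset.mem_map.1 hd
      rw [h.nonCrossing C₁ hC₁ C₂ hC₂ a ha' b hb' c hc' d hd' (f.lt_iff_lt.1 hab)
        (f.lt_iff_lt.1 hbc) (f.lt_iff_lt.1 hcd)]

theorem sum_nonCrossingPartitionsOn_map {α β : Type*} [LinearOrder α] [LinearOrder β]
    (f : α ↪o β) (s : Finset α) (g : ℕ → ℝ) :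
    ∑ P ∈ nonCrossingPartitionsOn (s.map f.toEmbedding), g P.card =
      ∑ P ∈ nonCrossingPartitionsOn s, g P.card := by
  symm
  refine Finset.sum_nbij
    (fun P => P.map (Finset.mapEmbedding f.toEmbedding).toEmbedding) ?_ ?_ ?_ ?_
  · intro P hP
    rw [mem_nonCrossingPartitionsOn] at hP ⊢
    exact (isNonCrossingPartitionOn_map f s P).2 hP
  · exact (Finset.map_injective _).injOn
  · intro P' hP'
    rw [Finset.mem_coe, mem_nonCrossingPartitionsOn] at hP'
    have hsub : P' ⊆ (s.powerset).map (Finset.mapEmbedding f.toEmbedding).toEmbedding := by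
      intro B hB
      obtain ⟨u, hu, rfl⟩ := Finset.subset_map_iff.1 (fun x hx => hP'.subset B hB x hx)
      exact Finset.mem_map.2 ⟨u, Finset.mem_powerset.2 hu, rfl⟩
    obtain ⟨P, -, rfl⟩ := Finset.subset_map_iff.1 hsub
    refine ⟨P, ?_, rfl⟩
    rw [Finset.mem_coe, mem_nonCrossingPartitionsOn]
    exact (isNonCrossingPartitionOn_map f s P).1 hP'
  · intro P _
    rw [Finset.card_map]

theorem sum_NC_eq_sum_range (n : ℕ) (g : ℕ → ℝ) :
    ∑ P ∈ NC n, g P.card = ∑ P ∈ nonCrossingPartitionsOn (Finset.range n), g P.card := by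
  rw [NC_eq_nonCrossingPartitionsOn, ← sum_nonCrossingPartitionsOn_map (Fin.valOrderEmb n)]
  suffices h : Finset.univ.map (Fin.valOrderEmb n).toEmbedding = Finset.range n by rw [h]
  ext x
  simp only [Finset.mem_map, Finset.mem_range, Finset.mem_univ, true_and]
  exact ⟨fun ⟨i, hi⟩ => hi ▸ i.2, fun h => ⟨⟨x, h⟩, rfl⟩⟩

theorem sum_nonCrossingPartitionsOn_Ico (m n : ℕ) (g : ℕ → ℝ) :
    ∑ P ∈ nonCrossingPartitionsOn (Finset.Ico m n), g P.card =
      ∑ P ∈ nonCrossingPartitionsOn (Finset.range (n - m)), g P.card := by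
  rw [← sum_nonCrossingPartitionsOn_map (OrderEmbedding.addLeft m) (Finset.range (n - m))]
  suffices h : (Finset.range (n - m)).map (OrderEmbedding.addLeft m).toEmbedding =
      Finset.Ico m n by rw [h]
  ext x
  simp only [Finset.mem_map, Finset.mem_range, Finset.mem_Ico]
  constructor
  · rintro ⟨i, hi, rfl⟩
    simp; omega
  · intro h
    exact ⟨x - m, by omega, by simp; omega⟩

theorem sum_nonCrossingPartitionsOn_singleton_mem (n : ℕ) (g : ℕ → ℝ) :
    ∑ P ∈ nonCrossingPartitionsOn (Finset.range (n + 1)) with {n} ∈ P, g P.card =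
      ∑ P ∈ nonCrossingPartitionsOn (Finset.range n), g (P.card + 1) := by
  symm
  have hnot : ∀ P, IsNonCrossingPartitionOn (Finset.range n) P → {n} ∉ P := by
    intro P hP h
    simpa using hP.subset _ h n (Finset.mem_singleton_self n)
  refine Finset.sum_nbij' (fun P => insert {n} P) (fun P => P.erase {n}) ?_ ?_ ?_ ?_ ?_
  · intro P hP
    rw [mem_nonCrossingPartitionsOn] at hP
    rw [Finset.mem_filter, mem_nonCrossingPartitionsOn]
    refine ⟨?_, Finset.mem_insert_self _ _⟩
    constructor
    · intro B hB
      rcases Finset.mem_insert.1 hB with rfl | hB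
      · exact Finset.singleton_nonempty n
      · exact hP.nonempty B hB
    · intro B hB x hx
      rw [Finset.mem_range]
      rcases Finset.mem_insert.1 hB with rfl | hB
      · rw [Finset.mem_singleton.1 hx]
        exact n.lt_succ_self
      · exact (Finset.mem_range.1 (hP.subset B hB x hx)).trans n.lt_succ_self
    · intro x hx
      rcases (Nat.lt_succ_iff.1 (Finset.mem_range.1 hx)).lt_or_eq with h | rfl
      · obtain ⟨B, hB, hxB⟩ := hP.cover x (Finset.mem_range.2 h)
        exact ⟨B, Finset.mem_insert_of_mem hB, hxB⟩
      · exact ⟨_, Finset.mem_insert_self _ _, Finset.mem_singleton_self x⟩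
    · intro B₁ h₁ B₂ h₂ x hx₁ hx₂
      rcases Finset.mem_insert.1 h₁ with rfl | h₁ <;> rcases Finset.mem_insert.1 h₂ with rfl | h₂
      · rfl
      · rw [Finset.mem_singleton] at hx₁
        have := Finset.mem_range.1 (hP.subset B₂ h₂ x hx₂)
        omega
      · rw [Finset.mem_singleton] at hx₂
        have := Finset.mem_range.1 (hP.subset B₁ h₁ x hx₁)
        omega
      · exact hP.unique B₁ h₁ B₂ h₂ x hx₁ hx₂
    · intro B₁ h₁ B₂ h₂ a ha b hb c hc d hd hab hbc hcd
      rcases Finset.mem_insert.1 h₁ with rfl | h₁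
      · rw [Finset.mem_singleton] at ha hc
        omega
      rcases Finset.mem_insert.1 h₂ with rfl | h₂
      · rw [Finset.mem_singleton] at hb hd
        omega
      exact hP.nonCrossing B₁ h₁ B₂ h₂ a ha b hb c hc d hd hab hbc hcd
  · intro P hP
    rw [Finset.mem_filter, mem_nonCrossingPartitionsOn] at hP
    rw [mem_nonCrossingPartitionsOn]
    obtain ⟨⟨h₁, h₂, h₃, h₄, h₅⟩, h₆⟩ := hP
    constructor
    · exact fun B hB => h₁ B (Finset.mem_of_mem_erase hB)
    · intro B hB x hx
      have : x ≠ n := by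
        rintro rfl
        exact (Finset.mem_erase.1 hB).1
          (h₄ _ (Finset.mem_erase.1 hB).2 _ h₆ x hx (Finset.mem_singleton_self x))
      have := Finset.mem_range.1 (h₂ B (Finset.mem_erase.1 hB).2 x hx)
      rw [Finset.mem_range]
      omega
    · intro x hx
      rw [Finset.mem_range] at hx
      obtain ⟨B, hB, hxB⟩ := h₃ x (by rw [Finset.mem_range]; omega)
      refine ⟨B, Finset.mem_erase.2 ⟨?_, hB⟩, hxB⟩
      rintro rfl
      exact hx.ne (Finset.mem_singleton.1 hxB)
    · intro B₁ hB₁ B₂ hB₂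
      exact h₄ B₁ (Finset.mem_of_mem_erase hB₁) B₂ (Finset.mem_of_mem_erase hB₂)
    · intro B₁ hB₁ B₂ hB₂
      exact h₅ B₁ (Finset.mem_of_mem_erase hB₁) B₂ (Finset.mem_of_mem_erase hB₂)
  · intro P hP
    exact Finset.erase_insert (hnot P (mem_nonCrossingPartitionsOn.1 hP))
  · intro P hP
    exact Finset.insert_erase (Finset.mem_filter.1 hP).2
  · intro P hP
    rw [Finset.card_insert_of_notMem (hnot P (mem_nonCrossingPartitionsOn.1 hP))]

/-- `p` is the element preceding `n` in its block of `P`. -/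
def IsBlockPred (P : Finset (Finset ℕ)) (p n : ℕ) : Prop :=
  ∃ B ∈ P, n ∈ B ∧ p ∈ B ∧ p < n ∧ ∀ x ∈ B, x ≤ p ∨ n ≤ x

/-- Attach `n` to the block containing `p`. -/
def attach (p n : ℕ) (B : Finset ℕ) : Finset ℕ := if p ∈ B then insert n B else B

/-- The blocks of `P` after attaching `n` to the block of `p`, together with the blocks of `R`. -/
def glue (p n : ℕ) (Q R : Finset (Finset ℕ)) : Finset (Finset ℕ) := Q.image (attach p n) ∪ R

/-- The partition induced on the complement of the interval `Ico (p + 1) (n + 1)`. -/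
def outerPart (p n : ℕ) (P : Finset (Finset ℕ)) : Finset (Finset ℕ) :=
  (P.filter fun B => ¬ B ⊆ Finset.Ico (p + 1) n).image fun B => B.erase n

/-- The blocks of `P` inside the interval `Ico (p + 1) n`. -/
def innerPart (p n : ℕ) (P : Finset (Finset ℕ)) : Finset (Finset ℕ) :=
  P.filter fun B => B ⊆ Finset.Ico (p + 1) n

theorem mem_attach {p n x : ℕ} {B : Finset ℕ} :
    x ∈ attach p n B ↔ x ∈ B ∨ (p ∈ B ∧ x = n) := by
  unfold attach
  split_ifs <;> grind

theorem erase_attach {p n : ℕ} {B : Finset ℕ} (hB : n ∉ B) : (attach p n B).erase n = B := by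
  unfold attach
  split_ifs <;> grind

section glue

variable {p n : ℕ} {P Q R : Finset (Finset ℕ)}

theorem IsNonCrossingPartitionOn.notMem_of_range (hp : p < n)
    (hQ : IsNonCrossingPartitionOn (Finset.range (p + 1)) Q) {B : Finset ℕ} (hB : B ∈ Q) :
    n ∉ B := by
  intro h
  have := Finset.mem_range.1 (hQ.subset B hB n h)
  omega

theorem isNonCrossingPartitionOn_glue (hp : p < n)
    (hQ : IsNonCrossingPartitionOn (Finset.range (p + 1)) Q)
    (hR : IsNonCrossingPartitionOn (Finset.Ico (p + 1) n) R) :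
    IsNonCrossingPartitionOn (Finset.range (n + 1)) (glue p n Q R) := by
  obtain ⟨h₁, h₂, h₃, h₄, h₅⟩ := hQ
  obtain ⟨k₁, k₂, k₃, k₄, k₅⟩ := hR
  simp only [Finset.mem_range] at h₂ h₃
  simp only [Finset.mem_Ico] at k₂ k₃
  have key : ∀ B, B ∈ glue p n Q R ↔ (∃ C ∈ Q, attach p n C = B) ∨ B ∈ R := by
    simp [glue]
  constructor
  · intro B hB
    rcases (key B).1 hB with ⟨C, hC, rfl⟩ | hB
    · obtain ⟨x, hx⟩ := h₁ C hC
      exact ⟨x, mem_attach.2 (Or.inl hx)⟩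
    · exact k₁ B hB
  · intro B hB x hx
    rw [Finset.mem_range]
    rcases (key B).1 hB with ⟨C, hC, rfl⟩ | hB
    · rcases mem_attach.1 hx with hx | ⟨-, rfl⟩
      · have := h₂ C hC x hx
        omega
      · omega
    · have := k₂ B hB x hx
      omega
  · intro x hx
    rw [Finset.mem_range] at hx
    rcases Nat.lt_or_ge x (p + 1) with hxp | hxp
    · obtain ⟨C, hC, hxC⟩ := h₃ x hxp
      exact ⟨_, (key _).2 (Or.inl ⟨C, hC, rfl⟩), mem_attach.2 (Or.inl hxC)⟩
    · rcases Nat.lt_or_ge x n with hxn | hxn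
      · obtain ⟨C, hC, hxC⟩ := k₃ x ⟨hxp, hxn⟩
        exact ⟨C, (key _).2 (Or.inr hC), hxC⟩
      · obtain ⟨C, hC, hpC⟩ := h₃ p (by omega)
        exact ⟨_, (key _).2 (Or.inl ⟨C, hC, rfl⟩), mem_attach.2 (Or.inr ⟨hpC, by omega⟩)⟩
  · intro B₁ hB₁ B₂ hB₂ x hx₁ hx₂
    rcases (key B₁).1 hB₁ with ⟨C₁, hC₁, rfl⟩ | hB₁ <;>
    rcases (key B₂).1 hB₂ with ⟨C₂, hC₂, rfl⟩ | hB₂ <;>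
    try simp only [mem_attach] at hx₁ hx₂
    · congr 1
      grind
    · grind
    · grind
    · exact k₄ B₁ hB₁ B₂ hB₂ x hx₁ hx₂
  · intro B₁ hB₁ B₂ hB₂ a ha b hb c hc d hd hab hbc hcd
    rcases (key B₁).1 hB₁ with ⟨C₁, hC₁, rfl⟩ | hB₁ <;>
    rcases (key B₂).1 hB₂ with ⟨C₂, hC₂, rfl⟩ | hB₂ <;>
    try simp only [mem_attach] at ha hb hc hd
    · congr 1
      have ha' : a ∈ C₁ := by grind
      have hb' : b ∈ C₂ := by grind
      have hc' : c ∈ C₁ := by grind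
      rcases hd with hd | ⟨hd, rfl⟩
      · exact h₅ C₁ hC₁ C₂ hC₂ a ha' b hb' c hc' d hd hab hbc hcd
      · rcases (Nat.lt_succ_iff.1 (h₂ C₁ hC₁ c hc')).lt_or_eq with h | rfl
        · exact h₅ C₁ hC₁ C₂ hC₂ a ha' b hb' c hc' p hd hab hbc h
        · exact h₄ C₁ hC₁ C₂ hC₂ c hc' hd
    · grind
    · grind
    · exact k₅ B₁ hB₁ B₂ hB₂ a ha b hb c hc d hd hab hbc hcd

theorem isBlockPred_glue (hp : p < n)
    (hQ : IsNonCrossingPartitionOn (Finset.range (p + 1)) Q) :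
    IsBlockPred (glue p n Q R) p n := by
  obtain ⟨C, hC, hpC⟩ := hQ.cover p (by simp)
  refine ⟨attach p n C, Finset.mem_union_left _ (Finset.mem_image_of_mem _ hC),
    mem_attach.2 (Or.inr ⟨hpC, rfl⟩), mem_attach.2 (Or.inl hpC), hp, fun x hx => ?_⟩
  rcases mem_attach.1 hx with hx | ⟨-, rfl⟩
  · exact Or.inl (Nat.lt_succ_iff.1 (Finset.mem_range.1 (hQ.subset C hC x hx)))
  · exact Or.inr le_rfl

theorem not_attach_subset_Ico (hQ : IsNonCrossingPartitionOn (Finset.range (p + 1)) Q)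
    {B : Finset ℕ} (hB : B ∈ Q) : ¬ attach p n B ⊆ Finset.Ico (p + 1) n := by
  intro h
  obtain ⟨x, hx⟩ := hQ.nonempty B hB
  have h₁ := Finset.mem_range.1 (hQ.subset B hB x hx)
  have h₂ := Finset.mem_Ico.1 (h (mem_attach.2 (Or.inl hx)))
  omega

theorem outerPart_glue (hp : p < n)
    (hQ : IsNonCrossingPartitionOn (Finset.range (p + 1)) Q)
    (hR : IsNonCrossingPartitionOn (Finset.Ico (p + 1) n) R) :
    outerPart p n (glue p n Q R) = Q := by
  have hfilter : (glue p n Q R).filter (fun B => ¬ B ⊆ Finset.Ico (p + 1) n) =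
      Q.image (attach p n) := by
    rw [glue, Finset.filter_union, Finset.filter_true_of_mem, Finset.filter_false_of_mem,
      Finset.union_empty]
    · exact fun B hB => not_not.2 (hR.subset B hB)
    · intro B hB
      obtain ⟨C, hC, rfl⟩ := Finset.mem_image.1 hB
      exact not_attach_subset_Ico hQ hC
  rw [outerPart, hfilter, Finset.image_image]
  conv_rhs => rw [← Finset.image_id (s := Q)]
  exact Finset.image_congr fun B hB => erase_attach (hQ.notMem_of_range hp hB)

theorem innerPart_glue (hQ : IsNonCrossingPartitionOn (Finset.range (p + 1)) Q)
    (hR : IsNonCrossingPartitionOn (Finset.Ico (p + 1) n) R) :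
    innerPart p n (glue p n Q R) = R := by
  rw [innerPart, glue, Finset.filter_union, Finset.filter_false_of_mem, Finset.filter_true_of_mem,
    Finset.empty_union]
  · exact hR.subset
  · intro B hB
    obtain ⟨C, hC, rfl⟩ := Finset.mem_image.1 hB
    exact not_attach_subset_Ico hQ hC

theorem card_glue (hp : p < n)
    (hQ : IsNonCrossingPartitionOn (Finset.range (p + 1)) Q)
    (hR : IsNonCrossingPartitionOn (Finset.Ico (p + 1) n) R) :
    (glue p n Q R).card = Q.card + R.card := by
  rw [glue, Finset.card_union_of_disjoint, Finset.card_image_of_injOn]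
  · intro B hB C hC h
    rw [← erase_attach (hQ.notMem_of_range hp hB), ← erase_attach (hQ.notMem_of_range hp hC)]
    exact congrArg (fun B => B.erase n) h
  · rw [Finset.disjoint_left]
    intro B hB hBR
    obtain ⟨C, hC, rfl⟩ := Finset.mem_image.1 hB
    exact not_attach_subset_Ico hQ hC (hR.subset _ hBR)

theorem subset_Ico_or_of_isBlockPred
    (hP : IsNonCrossingPartitionOn (Finset.range (n + 1)) P) (hpred : IsBlockPred P p n)
    {B : Finset ℕ} (hB : B ∈ P) :
    B ⊆ Finset.Ico (p + 1) n ∨ ∀ x ∈ B, x ≤ p ∨ x = n := by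
  obtain ⟨N, hN, hnN, hpN, hp, hgap⟩ := hpred
  by_contra! h
  obtain ⟨h, x, hx, hxp, hxn⟩ := h
  obtain ⟨y, hy, hyI⟩ := Finset.not_subset.1 h
  have hx' := Finset.mem_range.1 (hP.subset B hB x hx)
  have hy' := Finset.mem_range.1 (hP.subset B hB y hy)
  have hBN : B ≠ N := by
    rintro rfl
    have := hgap x hx
    omega
  rw [Finset.mem_Ico] at hyI
  have hyp : y ≠ p := by
    rintro rfl
    exact hBN (hP.unique B hB N hN y hy hpN)
  have hyn : y ≠ n := by
    rintro rfl
    exact hBN (hP.unique B hB N hN y hy hnN)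
  exact hBN (hP.nonCrossing B hB N hN y hy p hpN x hx n hnN (by omega) (by omega) (by omega))

theorem isNonCrossingPartitionOn_innerPart
    (hP : IsNonCrossingPartitionOn (Finset.range (n + 1)) P) (hpred : IsBlockPred P p n) :
    IsNonCrossingPartitionOn (Finset.Ico (p + 1) n) (innerPart p n P) := by
  have key : ∀ B, B ∈ innerPart p n P ↔ B ∈ P ∧ B ⊆ Finset.Ico (p + 1) n := by simp [innerPart]
  constructor
  · exact fun B hB => hP.nonempty B ((key B).1 hB).1
  · exact fun B hB => ((key B).1 hB).2
  · intro x hx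
    rw [Finset.mem_Ico] at hx
    obtain ⟨B, hB, hxB⟩ := hP.cover x (by rw [Finset.mem_range]; omega)
    refine ⟨B, (key B).2 ⟨hB, ?_⟩, hxB⟩
    refine (subset_Ico_or_of_isBlockPred hP hpred hB).resolve_right fun h => ?_
    have := h x hxB
    omega
  · exact fun B₁ h₁ B₂ h₂ => hP.unique B₁ ((key _).1 h₁).1 B₂ ((key _).1 h₂).1
  · exact fun B₁ h₁ B₂ h₂ => hP.nonCrossing B₁ ((key _).1 h₁).1 B₂ ((key _).1 h₂).1

theorem mem_outerPart
    (hP : IsNonCrossingPartitionOn (Finset.range (n + 1)) P) (hpred : IsBlockPred P p n)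
    {B : Finset ℕ} :
    B ∈ outerPart p n P ↔ ∃ C ∈ P, (∀ x ∈ C, x ≤ p ∨ x = n) ∧ C.erase n = B := by
  simp only [outerPart, Finset.mem_image, Finset.mem_filter, and_assoc]
  refine exists_congr fun C => and_congr_right fun hC => and_congr_left fun _ => ?_
  refine ⟨(subset_Ico_or_of_isBlockPred hP hpred hC).resolve_left, fun h hsub => ?_⟩
  obtain ⟨x, hx⟩ := hP.nonempty C hC
  have h₁ := h x hx
  have h₂ := Finset.mem_Ico.1 (hsub hx)
  omega

theorem isNonCrossingPartitionOn_outerPart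
    (hP : IsNonCrossingPartitionOn (Finset.range (n + 1)) P) (hpred : IsBlockPred P p n) :
    IsNonCrossingPartitionOn (Finset.range (p + 1)) (outerPart p n P) := by
  have key := @mem_outerPart p n P hP hpred
  have hpred' := hpred
  obtain ⟨N, hN, hnN, hpN, hp, hgap⟩ := hpred'
  constructor
  · intro B hB
    obtain ⟨C, hC, hCx, rfl⟩ := key.1 hB
    obtain ⟨x, hx⟩ := hP.nonempty C hC
    by_cases hn : n ∈ C
    · obtain rfl := hP.unique C hC N hN n hn hnN
      exact ⟨p, Finset.mem_erase.2 ⟨hp.ne, hpN⟩⟩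
    · exact ⟨x, Finset.mem_erase.2 ⟨fun h => hn (h ▸ hx), hx⟩⟩
  · intro B hB x hx
    obtain ⟨C, hC, hCx, rfl⟩ := key.1 hB
    rw [Finset.mem_erase] at hx
    have := hCx x hx.2
    rw [Finset.mem_range]
    omega
  · intro x hx
    rw [Finset.mem_range] at hx
    obtain ⟨B, hB, hxB⟩ := hP.cover x (by rw [Finset.mem_range]; omega)
    refine ⟨B.erase n, key.2 ⟨B, hB, ?_, rfl⟩, Finset.mem_erase.2 ⟨by omega, hxB⟩⟩
    refine (subset_Ico_or_of_isBlockPred hP hpred hB).resolve_left fun h => ?_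
    have := Finset.mem_Ico.1 (h hxB)
    omega
  · intro B₁ h₁ B₂ h₂ x hx₁ hx₂
    obtain ⟨C₁, hC₁, -, rfl⟩ := key.1 h₁
    obtain ⟨C₂, hC₂, -, rfl⟩ := key.1 h₂
    rw [hP.unique C₁ hC₁ C₂ hC₂ x (Finset.mem_of_mem_erase hx₁) (Finset.mem_of_mem_erase hx₂)]
  · intro B₁ h₁ B₂ h₂ a ha b hb c hc d hd hab hbc hcd
    obtain ⟨C₁, hC₁, -, rfl⟩ := key.1 h₁
    obtain ⟨C₂, hC₂, -, rfl⟩ := key.1 h₂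
    rw [hP.nonCrossing C₁ hC₁ C₂ hC₂ a (Finset.mem_of_mem_erase ha) b (Finset.mem_of_mem_erase hb)
      c (Finset.mem_of_mem_erase hc) d (Finset.mem_of_mem_erase hd) hab hbc hcd]

theorem glue_outerPart_innerPart
    (hP : IsNonCrossingPartitionOn (Finset.range (n + 1)) P) (hpred : IsBlockPred P p n) :
    glue p n (outerPart p n P) (innerPart p n P) = P := by
  have key := @mem_outerPart p n P hP hpred
  have hpred' := hpred
  obtain ⟨N, hN, hnN, hpN, hp, hgap⟩ := hpred'
  have hattach : ∀ C ∈ P, attach p n (C.erase n) = C := by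
    intro C hC
    have hmem : p ∈ C ↔ n ∈ C :=
      ⟨fun h => hP.unique C hC N hN p h hpN ▸ hnN, fun h => hP.unique C hC N hN n h hnN ▸ hpN⟩
    ext x
    rw [mem_attach]
    grind
  ext B
  simp only [glue, Finset.mem_union, Finset.mem_image, key]
  constructor
  · rintro (⟨_, ⟨C, hC, -, rfl⟩, rfl⟩ | hB)
    · rwa [hattach C hC]
    · exact (Finset.mem_filter.1 hB).1
  · intro hB
    rcases subset_Ico_or_of_isBlockPred hP hpred hB with h | h
    · exact Or.inr (Finset.mem_filter.2 ⟨hB, h⟩)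
    · exact Or.inl ⟨_, ⟨B, hB, h, rfl⟩, hattach B hB⟩

end glue

open Classical in
theorem sum_nonCrossingPartitionsOn_isBlockPred {p n : ℕ} (hp : p < n) (c : ℝ) :
    ∑ P ∈ nonCrossingPartitionsOn (Finset.range (n + 1)) with IsBlockPred P p n, c ^ P.card =
      (∑ P ∈ nonCrossingPartitionsOn (Finset.range (p + 1)), c ^ P.card) *
        ∑ P ∈ nonCrossingPartitionsOn (Finset.Ico (p + 1) n), c ^ P.card := by
  rw [Finset.sum_mul_sum, ← Finset.sum_product']
  refine Finset.sum_nbij' (fun P => (outerPart p n P, innerPart p n P))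
    (fun PQ => glue p n PQ.1 PQ.2) ?_ ?_ ?_ ?_ ?_
  · intro P hP
    rw [Finset.mem_filter, mem_nonCrossingPartitionsOn] at hP
    rw [Finset.mem_product, mem_nonCrossingPartitionsOn, mem_nonCrossingPartitionsOn]
    exact ⟨isNonCrossingPartitionOn_outerPart hP.1 hP.2,
      isNonCrossingPartitionOn_innerPart hP.1 hP.2⟩
  · intro PQ h
    rw [Finset.mem_product, mem_nonCrossingPartitionsOn, mem_nonCrossingPartitionsOn] at h
    rw [Finset.mem_filter, mem_nonCrossingPartitionsOn]
    exact ⟨isNonCrossingPartitionOn_glue hp h.1 h.2, isBlockPred_glue hp h.1⟩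
  · intro P hP
    rw [Finset.mem_filter, mem_nonCrossingPartitionsOn] at hP
    exact glue_outerPart_innerPart hP.1 hP.2
  · intro PQ h
    rw [Finset.mem_product, mem_nonCrossingPartitionsOn, mem_nonCrossingPartitionsOn] at h
    exact Prod.ext (outerPart_glue hp h.1 h.2) (innerPart_glue h.1 h.2)
  · intro P hP
    rw [Finset.mem_filter, mem_nonCrossingPartitionsOn] at hP
    rw [← pow_add, ← card_glue (hp) (isNonCrossingPartitionOn_outerPart hP.1 hP.2)
      (isNonCrossingPartitionOn_innerPart hP.1 hP.2), glue_outerPart_innerPart hP.1 hP.2]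

theorem existsUnique_isBlockPred {n : ℕ} {P : Finset (Finset ℕ)}
    (hP : IsNonCrossingPartitionOn (Finset.range (n + 1)) P) (hn : {n} ∉ P) :
    ∃! p, p < n ∧ IsBlockPred P p n := by
  obtain ⟨N, hN, hnN⟩ := hP.cover n (by simp)
  have hlt : ∀ x ∈ N.erase n, x < n := by
    intro x hx
    rw [Finset.mem_erase] at hx
    have := Finset.mem_range.1 (hP.subset N hN x hx.2)
    omega
  have hne : (N.erase n).Nonempty := by
    rw [Finset.nonempty_iff_ne_empty]
    intro h
    rw [Finset.erase_eq_empty_iff] at h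
    rcases h with rfl | rfl
    · simp at hnN
    · exact hn hN
  have hmax := Finset.max'_mem _ hne
  refine ⟨(N.erase n).max' hne, ⟨hlt _ hmax, N, hN, hnN, Finset.mem_of_mem_erase hmax,
    hlt _ hmax, fun x hx => ?_⟩, ?_⟩
  · by_cases hxn : x = n
    · exact Or.inr hxn.ge
    · exact Or.inl (Finset.le_max' _ _ (Finset.mem_erase.2 ⟨hxn, hx⟩))
  · rintro q ⟨hq, B, hB, hnB, hqB, -, hgap⟩
    obtain rfl := hP.unique B hB N hN n hnB hnN
    apply le_antisymm
    · exact Finset.le_max' _ _ (Finset.mem_erase.2 ⟨hq.ne, hqB⟩)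
    · have h₁ := hgap _ (Finset.mem_of_mem_erase hmax)
      have h₂ := hlt _ hmax
      omega

/-- The generating polynomial of the number of blocks of non-crossing partitions of `[n]`. -/
noncomputable def blockPoly (c : ℝ) (n : ℕ) : ℝ :=
  ∑ P ∈ nonCrossingPartitionsOn (Finset.range n), c ^ P.card

theorem blockPoly_zero (c : ℝ) : blockPoly c 0 = 1 := by
  have h : nonCrossingPartitionsOn (Finset.range 0) = {∅} := by
    ext P
    rw [mem_nonCrossingPartitionsOn, Finset.mem_singleton]
    constructor
    · intro h
      refine Finset.eq_empty_of_forall_notMem fun B hB => ?_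
      obtain ⟨x, hx⟩ := h.nonempty B hB
      simpa using h.subset B hB x hx
    · rintro rfl
      constructor <;> simp
  rw [blockPoly, h]
  simp

theorem blockPoly_succ_eq_sum_range (c : ℝ) (n : ℕ) :
    blockPoly c (n + 1) = c * blockPoly c n +
      ∑ p ∈ Finset.range n, blockPoly c (p + 1) * blockPoly c (n - (p + 1)) := by
  classical
  rw [blockPoly, ← Finset.sum_filter_add_sum_filter_not _ (fun P => {n} ∈ P)]
  congr 1
  · rw [sum_nonCrossingPartitionsOn_singleton_mem n (fun k => c ^ k), blockPoly, Finset.mul_sum]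
    exact Finset.sum_congr rfl fun P _ => pow_succ' c _
  · trans ∑ p ∈ Finset.range n,
        ∑ P ∈ nonCrossingPartitionsOn (Finset.range (n + 1)) with IsBlockPred P p n, c ^ P.card
    · simp only [Finset.sum_filter]
      rw [Finset.sum_comm]
      refine Finset.sum_congr rfl fun P hP => ?_
      rw [mem_nonCrossingPartitionsOn] at hP
      rw [← Finset.sum_filter]
      by_cases h : {n} ∈ P
      swap
      · rw [if_pos h]
        obtain ⟨p, hp, hu⟩ := existsUnique_isBlockPred hP h
        have : (Finset.range n).filter (fun p => IsBlockPred P p n) = {p} := by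
          ext q
          rw [Finset.mem_filter, Finset.mem_range, Finset.mem_singleton]
          exact ⟨hu q, fun h => h ▸ hp⟩
        rw [this, Finset.sum_singleton]
      · rw [if_neg (not_not.2 h), Finset.filter_false_of_mem, Finset.sum_empty]
        rintro p - ⟨B, hB, hnB, hpB, hp, -⟩
        have hB' := hP.unique B hB {n} h n hnB (Finset.mem_singleton_self n)
        rw [hB', Finset.mem_singleton] at hpB
        exact hp.ne hpB
    · refine Finset.sum_congr rfl fun p hp => ?_
      rw [sum_nonCrossingPartitionsOn_isBlockPred (Finset.mem_range.1 hp),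
        sum_nonCrossingPartitionsOn_Ico (p + 1) n (fun k => c ^ k)]
      rfl

theorem blockPoly_succ (c : ℝ) (n : ℕ) :
    blockPoly c (n + 1) = (c - 1) * blockPoly c n +
      ∑ ij ∈ Finset.HasAntidiagonal.antidiagonal n, blockPoly c ij.1 * blockPoly c ij.2 := by
  rw [blockPoly_succ_eq_sum_range,
    Finset.Nat.sum_antidiagonal_eq_sum_range_succ (fun i j => blockPoly c i * blockPoly c j),
    Finset.sum_range_succ', blockPoly_zero, Nat.sub_zero]
  ring

/-- The derivative of `blockPoly` with respect to its parameter. -/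
noncomputable def blockPolyDeriv (c : ℝ) (n : ℕ) : ℝ :=
  ∑ P ∈ nonCrossingPartitionsOn (Finset.range n), (P.card : ℝ) * c ^ (P.card - 1)

theorem hasDerivAt_blockPoly (c : ℝ) (n : ℕ) :
    HasDerivAt (fun t => blockPoly t n) (blockPolyDeriv c n) c :=
  HasDerivAt.fun_sum fun P _ => hasDerivAt_pow P.card c

theorem blockPolyDeriv_zero (c : ℝ) : blockPolyDeriv c 0 = 0 := by
  refine (hasDerivAt_blockPoly c 0).unique ?_
  simp only [blockPoly_zero]
  exact hasDerivAt_const c 1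

theorem blockPolyDeriv_succ (c : ℝ) (n : ℕ) :
    blockPolyDeriv c (n + 1) = blockPoly c n + (c - 1) * blockPolyDeriv c n +
      ∑ ij ∈ Finset.HasAntidiagonal.antidiagonal n, (blockPolyDeriv c ij.1 * blockPoly c ij.2 +
        blockPoly c ij.1 * blockPolyDeriv c ij.2) := by
  refine (hasDerivAt_blockPoly c (n + 1)).unique ?_
  simp only [blockPoly_succ]
  have h₁ := (((hasDerivAt_id c).sub_const 1).fun_mul (hasDerivAt_blockPoly c n))
  have h₂ := HasDerivAt.fun_sum (u := Finset.HasAntidiagonal.antidiagonal n) fun ij _ =>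
    (hasDerivAt_blockPoly c ij.1).fun_mul (hasDerivAt_blockPoly c ij.2)
  simpa using h₁.fun_add h₂

/-- The moments of the arcsine law on `[(1 - √c) ^ 2, (1 + √c) ^ 2]`, up to the factor `π`. -/
noncomputable def arcsineMoment (c : ℝ) (n : ℕ) : ℝ :=
  ∫ θ in (0 : ℝ)..Real.pi, (1 + c + 2 * √c * Real.cos θ) ^ n

theorem arcsineMoment_recurrence {c : ℝ} (hc : 0 ≤ c) (n : ℕ) :
    (n + 2) * arcsineMoment c (n + 2) =
      (2 * n + 3) * (1 + c) * arcsineMoment c (n + 1)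
        - (n + 1) * (1 - c) ^ 2 * arcsineMoment c n := by
  set f : ℝ → ℝ := fun θ => 1 + c + 2 * √c * Real.cos θ with hf
  have hfd : ∀ θ, HasDerivAt f (-(2 * √c * Real.sin θ)) θ := fun θ => by
    exact (((Real.hasDerivAt_cos θ).const_mul (2 * √c)).const_add (1 + c)).congr_deriv (by ring)
  have hd : ∀ θ, HasDerivAt (fun θ => f θ ^ (n + 1) * (2 * √c * Real.sin θ))
      ((n + 2) * f θ ^ (n + 2) - (2 * n + 3) * (1 + c) * f θ ^ (n + 1)
        + (n + 1) * (1 - c) ^ 2 * f θ ^ n) θ := fun θ => by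
    have h := ((hfd θ).fun_pow (n + 1)).fun_mul ((Real.hasDerivAt_sin θ).const_mul (2 * √c))
    refine h.congr_deriv ?_
    have hs := Real.sin_sq_add_cos_sq θ
    have hq := Real.sq_sqrt hc
    have hcos : 2 * √c * Real.cos θ = f θ - (1 + c) := by simp [hf]
    have hsin : (2 * √c * Real.sin θ) ^ 2 = 4 * c - (f θ - (1 + c)) ^ 2 := by
      rw [← hcos]
      linear_combination (4 * √c ^ 2) * hs + 4 * hq
    rw [hcos]
    push_cast
    linear_combination (-(n + 1) * f θ ^ n) * hsin
  have hcont : Continuous f := by fun_prop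
  have hint : ∀ k, IntervalIntegrable (fun θ => f θ ^ k) MeasureTheory.volume 0 Real.pi :=
    fun k => (hcont.pow k).intervalIntegrable _ _
  have h := intervalIntegral.integral_eq_sub_of_hasDerivAt (fun θ _ => hd θ)
    ((((hint (n + 2)).const_mul _).sub ((hint (n + 1)).const_mul _)).add
      ((hint n).const_mul _))
  rw [intervalIntegral.integral_add (((hint (n + 2)).const_mul _).sub ((hint (n + 1)).const_mul _))
      ((hint n).const_mul _),
    intervalIntegral.integral_sub ((hint (n + 2)).const_mul _) ((hint (n + 1)).const_mul _)] at h
  simp only [intervalIntegral.integral_const_mul, Real.sin_pi, Real.sin_zero, mul_zero,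
    sub_zero] at h
  simp only [arcsineMoment]
  linear_combination h

theorem arcsineMoment_zero (c : ℝ) : arcsineMoment c 0 = Real.pi := by
  simp [arcsineMoment]

theorem arcsineMoment_one (c : ℝ) : arcsineMoment c 1 = (1 + c) * Real.pi := by
  have h : IntervalIntegrable (fun θ => 2 * √c * Real.cos θ) MeasureTheory.volume 0 Real.pi :=
    Continuous.intervalIntegrable (by fun_prop) _ _
  simp only [arcsineMoment, pow_one]
  rw [intervalIntegral.integral_add intervalIntegrable_const h,
    intervalIntegral.integral_const_mul, integral_cos]
  simp
  ring

open PowerSeries in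
theorem coeff_inv_eq_arcsineMoment {c : ℝ} (hc : 0 ≤ c) {S : ℝ⟦X⟧}
    (hS₀ : constantCoeff S = 1)
    (hS : S ^ 2 = 1 - C (2 * (1 + c)) * X + C ((1 - c) ^ 2) * X ^ 2) (n : ℕ) :
    Real.pi * coeff n S⁻¹ = arcsineMoment c n := by
  set E := S⁻¹ with hE
  have hSE : S * E = 1 := PowerSeries.mul_inv_cancel S (by rw [hS₀]; exact one_ne_zero)
  have hE₀ : coeff 0 E = 1 := by
    have := congrArg constantCoeff hSE
    simpa [hS₀] using this
  have hdS : 2 * S * d⁄dX ℝ S = -C (2 * (1 + c)) + 2 * C ((1 - c) ^ 2) * X := by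
    have := congrArg (d⁄dX ℝ) hS
    generalize (1 - c) ^ 2 = β at this ⊢
    generalize 2 * (1 + c) = α at this ⊢
    simp only [pow_two, Derivation.leibniz, map_add, map_sub, derivative_C, derivative_X,
      smul_eq_mul, Derivation.map_one_eq_zero] at this
    linear_combination this
  have hdE : S * d⁄dX ℝ E + E * d⁄dX ℝ S = 0 := by
    have := congrArg (d⁄dX ℝ) hSE
    simpa [Derivation.leibniz] using this
  have hode : (1 - C (2 * (1 + c)) * X + C ((1 - c) ^ 2) * X ^ 2) * d⁄dX ℝ E
      = (C (1 + c) - C ((1 - c) ^ 2) * X) * E := by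
    have h2 : (2 : ℝ⟦X⟧) ≠ 0 := by
      have := (map_ne_zero_iff (C (R := ℝ)) C_injective).2 (two_ne_zero' ℝ)
      rwa [map_ofNat] at this
    refine mul_left_cancel₀ h2 ?_
    rw [← hS]
    have hC : C (2 * (1 + c)) = 2 * C (R := ℝ) (1 + c) := by
      rw [map_mul, map_ofNat]
    rw [hC] at hdS
    linear_combination 2 * S * hdE - E * hdS
  have hrec : ∀ n : ℕ, (n + 2) * coeff (n + 2) E =
      (2 * n + 3) * (1 + c) * coeff (n + 1) E - (n + 1) * (1 - c) ^ 2 * coeff n E := by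
    intro n
    have h := congrArg (coeff (n + 1)) hode
    generalize 1 + c = α, (1 - c) ^ 2 = β at h ⊢
    rw [add_mul, sub_mul, one_mul, sub_mul, mul_assoc, mul_assoc, mul_assoc] at h
    simp only [map_add, map_sub, coeff_C_mul, pow_two X, mul_assoc, coeff_succ_X_mul,
      coeff_derivative] at h
    rcases n with _ | n
    · simp only [zero_add, coeff_zero_X_mul] at h ⊢
      push_cast at h ⊢
      linear_combination h
    · simp only [coeff_derivative, coeff_succ_X_mul] at h ⊢
      push_cast at h ⊢
      linear_combination h
  have hE₁ : coeff 1 E = 1 + c := by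
    have h := congrArg (coeff 0) hode
    generalize 1 + c = α, (1 - c) ^ 2 = β at h ⊢
    rw [add_mul, sub_mul, one_mul, sub_mul, mul_assoc, mul_assoc, mul_assoc] at h
    simp only [map_add, map_sub, coeff_C_mul, pow_two X, mul_assoc, coeff_zero_X_mul,
      coeff_derivative, hE₀] at h
    push_cast at h
    linear_combination h
  suffices h : Real.pi * coeff n E = arcsineMoment c n ∧
      Real.pi * coeff (n + 1) E = arcsineMoment c (n + 1) from h.1
  induction n with
  | zero => exact ⟨by rw [hE₀, arcsineMoment_zero, mul_one], by
      rw [zero_add, hE₁, arcsineMoment_one, mul_comm]⟩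
  | succ n ih =>
    refine ⟨ih.2, ?_⟩
    have h2 : (n + 2 : ℝ) ≠ 0 := by positivity
    refine mul_left_cancel₀ h2 ?_
    rw [arcsineMoment_recurrence hc, ← ih.1, ← ih.2]
    linear_combination Real.pi * hrec n

open PowerSeries in
theorem two_pi_mul_blockPolyDeriv {c : ℝ} (hc : 0 ≤ c) (n : ℕ) :
    2 * Real.pi * blockPolyDeriv c (n + 1) =
      arcsineMoment c (n + 1) + (1 - c) * arcsineMoment c n := by
  set M : ℝ⟦X⟧ := PowerSeries.mk (blockPoly c) with hMdef
  set D : ℝ⟦X⟧ := PowerSeries.mk (blockPolyDeriv c) with hDdef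
  have hM : M = 1 + X * (C (c - 1) * M + M * M) := by
    ext k
    rcases k with _ | k
    · simp [hMdef, blockPoly_zero]
    · rw [map_add, coeff_succ_X_mul, map_add, coeff_C_mul, coeff_mul, coeff_one,
        if_neg k.succ_ne_zero, zero_add]
      simp only [hMdef, coeff_mk]
      exact blockPoly_succ c k
  have hD : D = X * (M + C (c - 1) * D + (D * M + M * D)) := by
    ext k
    rcases k with _ | k
    · simp [hDdef, blockPolyDeriv_zero]
    · rw [coeff_succ_X_mul, map_add, map_add, map_add, coeff_C_mul, coeff_mul, coeff_mul,
        ← Finset.sum_add_distrib]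
      simp only [hMdef, hDdef, coeff_mk]
      exact blockPolyDeriv_succ c k
  set S : ℝ⟦X⟧ := 1 - C (c - 1) * X - 2 * X * M with hSdef
  have hS₀ : constantCoeff S = 1 := by simp [hSdef]
  have hS : S ^ 2 = 1 - C (2 * (1 + c)) * X + C ((1 - c) ^ 2) * X ^ 2 := by
    simp only [hSdef, map_mul, map_add, map_sub, map_pow, map_one, map_ofNat]
    simp only [map_sub, map_one] at hM
    linear_combination (-4 * X) * hM
  have hSE : S * S⁻¹ = 1 := PowerSeries.mul_inv_cancel S (by rw [hS₀]; exact one_ne_zero)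
  have hDS : D * S = X * M := by
    rw [hSdef]
    linear_combination hD
  have h2D : C 2 * D = S⁻¹ + C (1 - c) * (X * S⁻¹) - 1 := by
    have hC2 : C (2 : ℝ) = 2 := map_ofNat C 2
    have hC : C (1 - c) = -C (c - 1) := by rw [← map_neg]; ring_nf
    rw [hC2, hC]
    linear_combination (2 * S⁻¹) * hDS - (2 * D + 1) * hSE - S⁻¹ * hSdef
  have h := congrArg (coeff (n + 1)) h2D
  rw [coeff_C_mul, map_sub, map_add, coeff_C_mul, coeff_succ_X_mul, coeff_one,
    if_neg n.succ_ne_zero, sub_zero, hDdef, coeff_mk] at h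
  rw [← coeff_inv_eq_arcsineMoment hc hS₀ hS, ← coeff_inv_eq_arcsineMoment hc hS₀ hS]
  linear_combination Real.pi * h

theorem image_arcsine_parametrization {c : ℝ} (hc : 0 < c) :
    (fun θ => 1 + c + 2 * √c * Real.cos θ) '' Set.Ioo 0 Real.pi =
      Set.Ioo ((1 - √c) ^ 2) ((1 + √c) ^ 2) := by
  have hs : 0 < √c := Real.sqrt_pos.2 hc
  have hq := Real.sq_sqrt hc.le
  ext x
  constructor
  · rintro ⟨θ, ⟨h₀, h₁⟩, rfl⟩
    have hlt : Real.cos θ < 1 := by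
      simpa using Real.cos_lt_cos_of_nonneg_of_le_pi le_rfl h₁.le h₀
    have hgt : -1 < Real.cos θ := by
      simpa using Real.cos_lt_cos_of_nonneg_of_le_pi h₀.le le_rfl h₁
    constructor <;> dsimp only <;> nlinarith
  · rintro ⟨h₀, h₁⟩
    have hl : -1 < (x - (1 + c)) / (2 * √c) := by
      rw [lt_div_iff₀ (by positivity)]; nlinarith
    have hr : (x - (1 + c)) / (2 * √c) < 1 := by
      rw [div_lt_one (by positivity)]; nlinarith
    refine ⟨Real.arccos ((x - (1 + c)) / (2 * √c)), ⟨Real.arccos_pos.2 hr, ?_⟩, ?_⟩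
    · refine lt_of_le_of_ne (Real.arccos_le_pi _) fun h => ?_
      rw [Real.arccos_eq_pi] at h
      linarith
    · dsimp only
      rw [Real.cos_arccos hl.le hr.le, mul_div_cancel₀ _ (by positivity)]
      ring

theorem integral_eq_integral_arcsine_parametrization {c : ℝ} (hc : 0 < c) (h : ℝ → ℝ) :
    ∫ x in ((1 - √c) ^ 2)..((1 + √c) ^ 2),
        h x / √(((1 + √c) ^ 2 - x) * (x - (1 - √c) ^ 2)) =
      ∫ θ in (0 : ℝ)..Real.pi, h (1 + c + 2 * √c * Real.cos θ) := by
  have hs : 0 < √c := Real.sqrt_pos.2 hc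
  have hq := Real.sq_sqrt hc.le
  have hle : (1 - √c) ^ 2 ≤ (1 + √c) ^ 2 := by nlinarith
  have hd : ∀ θ ∈ Set.Ioo 0 Real.pi, HasDerivWithinAt
      (fun θ => 1 + c + 2 * √c * Real.cos θ) (-(2 * √c * Real.sin θ)) (Set.Ioo 0 Real.pi) θ := by
    intro θ _
    have := ((Real.hasDerivAt_cos θ).const_mul (2 * √c)).const_add (1 + c)
    simpa using this.hasDerivWithinAt
  have hinj : Set.InjOn (fun θ => 1 + c + 2 * √c * Real.cos θ) (Set.Ioo 0 Real.pi) := by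
    intro θ hθ φ hφ heq
    refine Real.injOn_cos (Set.Ioo_subset_Icc_self hθ) (Set.Ioo_subset_Icc_self hφ) ?_
    have : 2 * √c * Real.cos θ = 2 * √c * Real.cos φ := by simpa using heq
    exact mul_left_cancel₀ (by positivity) this
  rw [intervalIntegral.integral_of_le hle, intervalIntegral.integral_of_le Real.pi_pos.le,
    MeasureTheory.integral_Ioc_eq_integral_Ioo, MeasureTheory.integral_Ioc_eq_integral_Ioo,
    ← image_arcsine_parametrization hc,
    MeasureTheory.integral_image_eq_integral_abs_deriv_smul measurableSet_Ioo hd hinj]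
  refine MeasureTheory.setIntegral_congr_fun measurableSet_Ioo fun θ hθ => ?_
  have hsin := Real.sin_pos_of_mem_Ioo hθ
  have hpos : 0 < 2 * √c * Real.sin θ := by positivity
  have hrad : ((1 + √c) ^ 2 - (1 + c + 2 * √c * Real.cos θ)) *
      (1 + c + 2 * √c * Real.cos θ - (1 - √c) ^ 2) = (2 * √c * Real.sin θ) ^ 2 := by
    have := Real.sin_sq_add_cos_sq θ
    have h₁ : (1 + √c) ^ 2 - (1 + c + 2 * √c * Real.cos θ) = 2 * √c * (1 - Real.cos θ) := by
      linear_combination hq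
    have h₂ : 1 + c + 2 * √c * Real.cos θ - (1 - √c) ^ 2 = 2 * √c * (1 + Real.cos θ) := by
      linear_combination -hq
    rw [h₁, h₂]
    linear_combination (-4 * √c ^ 2) * this
  rw [hrad, Real.sqrt_sq hpos.le, abs_neg, abs_of_pos hpos, smul_eq_mul,
    mul_div_cancel₀ _ hpos.ne']

/-- The n-th infinitesimal moment of the complex Wishart ensemble:
`∫_a^b xⁿ c'(x+1-c)/(2πx√((b-x)(x-a))) dx = ∑_{π∈NC(n)} #(π) c^{#(π)-1} c'`. -/
theorem stmt_13 (c c' : ℝ) (hc : 0 < c) (n : ℕ) (hn : 1 ≤ n) :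
    (∫ x in ((1 - Real.sqrt c) ^ 2)..((1 + Real.sqrt c) ^ 2),
        x ^ n * (c' * (x + 1 - c))
          / (2 * Real.pi * x *
              Real.sqrt (((1 + Real.sqrt c) ^ 2 - x) * (x - (1 - Real.sqrt c) ^ 2))))
      = ∑ P ∈ NC n, (P.card : ℝ) * c ^ (P.card - 1) * c' := by
  obtain ⟨n, rfl⟩ := Nat.exists_eq_succ_of_ne_zero (Nat.one_le_iff_ne_zero.1 hn)
  have hsum : ∑ P ∈ NC (n + 1), (P.card : ℝ) * c ^ (P.card - 1) * c' =
      blockPolyDeriv c (n + 1) * c' := by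
    rw [← Finset.sum_mul, sum_NC_eq_sum_range (n + 1) (fun k => (k : ℝ) * c ^ (k - 1))]
    rfl
  have hle : (1 - √c) ^ 2 ≤ (1 + √c) ^ 2 := by nlinarith [Real.sqrt_nonneg c]
  have hcongr : ∫ x in ((1 - √c) ^ 2)..((1 + √c) ^ 2),
        x ^ (n + 1) * (c' * (x + 1 - c))
          / (2 * Real.pi * x * √(((1 + √c) ^ 2 - x) * (x - (1 - √c) ^ 2))) =
      ∫ x in ((1 - √c) ^ 2)..((1 + √c) ^ 2),
        (c' / (2 * Real.pi) * (x ^ (n + 1) + (1 - c) * x ^ n))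
          / √(((1 + √c) ^ 2 - x) * (x - (1 - √c) ^ 2)) := by
    refine intervalIntegral.integral_congr_ae (Filter.Eventually.of_forall fun x hx => ?_)
    rw [Set.uIoc_of_le hle] at hx
    have hx0 : x ≠ 0 := ((sq_nonneg _).trans_lt hx.1).ne'
    rw [← div_div]
    congr 1
    have := Real.pi_ne_zero
    field_simp
    ring
  have hint : ∀ k, IntervalIntegrable (fun θ => (1 + c + 2 * √c * Real.cos θ) ^ k)
      MeasureTheory.volume 0 Real.pi :=
    fun k => Continuous.intervalIntegrable (by fun_prop) _ _
  rw [hsum, hcongr, integral_eq_integral_arcsine_parametrization hc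
      (fun x => c' / (2 * Real.pi) * (x ^ (n + 1) + (1 - c) * x ^ n)),
    intervalIntegral.integral_const_mul,
    intervalIntegral.integral_add (hint (n + 1)) ((hint n).const_mul _),
    intervalIntegral.integral_const_mul]
  have h := two_pi_mul_blockPolyDeriv hc.le n
  simp only [arcsineMoment] at h
  rw [← h]
  have := Real.pi_ne_zero
  field_simp
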